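/- Let Γ be a Coxeter graph with vertex set S and let X ⊆ S. If the word problem in the Artin group A[Γ] is solvable, then the strong membership problem for A_X[Γ] in A[Γ] is solvable: there is an algorithm that, given a word ω over S ⊔ S^{-1}, decides whether the element of A[Γ] represented by ω lies in A_X[Γ] and, if so, outputs a word over X ⊔ X^{-1} representing the same element. -/

import Mathlib

noncomputable instance (priority := 50) fintypePrimcodable {α : Type*} [Fintype α] [DecidableEq α] :
    Primcodable α :=
  Primcodable.ofEquiv (Fin (Fintype.card α)) (Fintype.equivFin α)

/-- The alternating product `a b a b ⋯` of length `m`. -/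
def altProd {G : Type*} [Monoid G] (a b : G) (m : ℕ) : G :=
  ((List.range m).map (fun i => if i % 2 = 0 then a else b)).prod

/-- The defining (braid) relations of the Artin group of a Coxeter matrix `M`.
The value `M s t = 0` encodes `m_{s,t} = ∞`. -/
def artinRels {S : Type*} (M : CoxeterMatrix S) : Set (FreeGroup S) :=
  {r | ∃ s t : S, s ≠ t ∧ M s t ≠ 0 ∧
      r = altProd (FreeGroup.of s) (FreeGroup.of t) (M s t) *
        (altProd (FreeGroup.of t) (FreeGroup.of s) (M s t))⁻¹}

/-- The Artin group `A[Γ]` of a Coxeter matrix. -/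
def ArtinGroup {S : Type*} (M : CoxeterMatrix S) : Type _ :=
  PresentedGroup (artinRels M)

instance {S : Type*} (M : CoxeterMatrix S) : Group (ArtinGroup M) := by
  unfold ArtinGroup; infer_instance

/-- The standard generator of the Artin group corresponding to `s`. -/
def ArtinGroup.gen {S : Type*} (M : CoxeterMatrix S) (s : S) : ArtinGroup M :=
  PresentedGroup.of s

/-- Evaluation in `G` of a word over an alphabet `A` of generators together with formal
inverses: the letter `(a, true)` is the generator `gen a` and `(a, false)` is its inverse. -/
def evalWord {A G : Type*} [Group G] (gen : A → G) (w : List (A × Bool)) : G :=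
  (w.map fun p => if p.2 then gen p.1 else (gen p.1)⁻¹).prod

/-- A group `G` has a solvable word problem with respect to a generating family `gen : A → G`
if there is an algorithm deciding whether a word over `A ⊔ A⁻¹` represents the identity. -/
def SolvableWordProblem {A G : Type*} [Primcodable A] [Group G] (gen : A → G) : Prop :=
  ComputablePred fun w : List (A × Bool) => evalWord gen w = 1

/-- The strong membership problem for the subgroup `H` of `G` is solvable (with respect to a
generating family `gen : A → G` of `G`, the subgroup `H` being generated by the generators
indexed by `Asub ⊆ A`): there is an algorithm that decides whether the element represented by a
word `w` over `A ⊔ A⁻¹` belongs to `H` and, if so, outputs a word all of whose letters come from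
`Asub ⊔ Asub⁻¹` representing the same element. -/
def SolvableStrongMembership {A G : Type*} [Primcodable A] [Group G] (gen : A → G)
    (Asub : Set A) (H : Subgroup G) : Prop :=
  ∃ f : List (A × Bool) → Option (List (A × Bool)), Computable f ∧
    ∀ w : List (A × Bool),
      (evalWord gen w ∈ H ↔ (f w).isSome) ∧
      ∀ μ, f w = some μ → (∀ p ∈ μ, p.1 ∈ Asub) ∧ evalWord gen μ = evalWord gen w

namespace CoxeterMatrix

open Module Polynomial.Chebyshev

variable {S : Type*} (M : CoxeterMatrix S)

/-- Twice the standard bilinear form of a Coxeter matrix, as a functional in the second argument. -/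
noncomputable def simpleCoroot (s : S) : Dual ℝ (S →₀ ℝ) :=
  Finsupp.lift ℝ ℝ S fun t => -2 * Real.cos (Real.pi / M s t)

theorem simpleCoroot_single (s t : S) :
    M.simpleCoroot s (Finsupp.single t 1) = -2 * Real.cos (Real.pi / M s t) := by
  simp [simpleCoroot]

theorem simpleCoroot_single_self (s : S) : M.simpleCoroot s (Finsupp.single s 1) = 2 := by
  simp [simpleCoroot_single]

/-- The reflection by which a simple generator acts in the geometric representation. -/
noncomputable def simpleReflection (s : S) : (S →₀ ℝ) ≃ₗ[ℝ] (S →₀ ℝ) :=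
  reflection (M.simpleCoroot_single_self s)

theorem simpleCoroot_mul_simpleCoroot (s t : S) :
    M.simpleCoroot s (Finsupp.single t 1) * M.simpleCoroot t (Finsupp.single s 1) - 2 =
      2 * Real.cos (2 * Real.pi / M s t) := by
  rw [simpleCoroot_single, simpleCoroot_single, M.symmetric t s, mul_div_assoc, Real.cos_two_mul]
  ring

theorem sin_two_pi_div_ne_zero {m : ℕ} (hm : 3 ≤ m) : Real.sin (2 * Real.pi / m) ≠ 0 := by
  have h3 : (3 : ℝ) ≤ m := by exact_mod_cast hm
  have := Real.pi_pos
  apply ne_of_gt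
  apply Real.sin_pos_of_pos_of_lt_pi (by positivity)
  rw [div_lt_iff₀ (by linarith)]
  nlinarith

theorem simpleReflection_mul_pow (s t : S) :
    (M.simpleReflection s * M.simpleReflection t) ^ M s t = 1 := by
  by_cases hst : s = t
  · subst hst
    rw [M.diagonal, pow_one]
    rw [mul_eq_one_iff_eq_inv, simpleReflection, reflection_inv]
  obtain h0 | h2 | h3 : M s t = 0 ∨ M s t = 2 ∨ 3 ≤ M s t := by
    have := M.off_diagonal s t hst
    omega
  · rw [h0, pow_zero]
  · apply LinearEquiv.ext
    intro z
    have h1 : M.simpleCoroot s (Finsupp.single t 1) = 0 := by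
      rw [simpleCoroot_single, h2]; simp
    have h1' : M.simpleCoroot t (Finsupp.single s 1) = 0 := by
      rw [simpleCoroot_single, M.symmetric, h2]; simp
    rw [h2, pow_two]
    simp only [simpleReflection, LinearEquiv.mul_apply, reflection_apply, map_sub, map_smul, h1,
      h1', simpleCoroot_single_self, LinearEquiv.coe_one, id_eq]
    module
  · apply LinearEquiv.ext
    intro z
    have hs := sin_two_pi_div_ne_zero h3
    have hm : (M s t : ℝ) ≠ 0 := by positivity
    rw [simpleReflection, simpleReflection, reflection_mul_reflection_pow_apply _ _ _ _ _
      (M.simpleCoroot_mul_simpleCoroot s t).symm]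
    have key (n : ℤ) := S_two_mul_real_cos (2 * Real.pi / M s t) n
    set θ := 2 * Real.pi / (M s t : ℝ) with hθ
    have hmθ : (M s t : ℝ) * θ = 2 * Real.pi := by rw [hθ]; field_simp
    obtain ⟨q, hq | hq⟩ := Nat.even_or_odd' (M s t)
    · have e1 : ((M s t : ℤ) - 2) / 2 = q - 1 := by omega
      have e2 : ((M s t : ℤ) - 1) / 2 = q - 1 := by omega
      have h : (Polynomial.Chebyshev.S ℝ ((q : ℤ) - 1)).eval (2 * Real.cos θ) = 0 := by
        have h1 := key (q - 1)
        have h2 : ((((q : ℤ) - 1 : ℤ) : ℝ) + 1) * θ = Real.pi := by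
          push_cast
          rw [hq] at hmθ
          push_cast at hmθ
          linarith
        rw [h2, Real.sin_pi] at h1
        exact (mul_eq_zero.mp h1).resolve_right hs
      rw [e1, e2, h]
      simp
    · have e1 : ((M s t : ℤ) - 2) / 2 = q - 1 := by omega
      have e2 : ((M s t : ℤ) - 1) / 2 = q := by omega
      have e3 : ((M s t : ℤ) - 3) / 2 = q - 1 := by omega
      have e4 : (M s t : ℤ) / 2 = q := by omega
      have h : (Polynomial.Chebyshev.S ℝ (q : ℤ)).eval (2 * Real.cos θ) +
          (Polynomial.Chebyshev.S ℝ ((q : ℤ) - 1)).eval (2 * Real.cos θ) = 0 := by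
        have h1 := key (q - 1)
        have h2 := key q
        have h3 : ((((q : ℤ) - 1 : ℤ) : ℝ) + 1) * θ =
            2 * Real.pi - (((q : ℤ) : ℝ) + 1) * θ := by
          rw [hq] at hmθ
          push_cast at hmθ ⊢
          linarith
        rw [h3, Real.sin_two_pi_sub] at h1
        refine (mul_eq_zero.mp (?_ : _ * Real.sin θ = 0)).resolve_right hs
        rw [add_mul, h1, h2]
        ring
      rw [e1, e2, e3, e4, h]
      simp

theorem le_of_simpleReflection_mul_pow {s t : S} (hst : s ≠ t) {k : ℕ} (hk : 0 < k)
    (h : (M.simpleReflection s * M.simpleReflection t) ^ k = 1) : M s t ≠ 0 ∧ M s t ≤ k := by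
  obtain h0 | h2 | h3 : M s t = 0 ∨ M s t = 2 ∨ 3 ≤ M s t := by
    have := M.off_diagonal s t hst
    omega
  · exfalso
    have h1 := LinearEquiv.congr_fun h (Finsupp.single s 1)
    rw [simpleReflection, simpleReflection, reflection_mul_reflection_pow_apply_self _ _ _ _
      (M.simpleCoroot_mul_simpleCoroot s t).symm] at h1
    have h2 := DFunLike.congr_fun h1 t
    simp [hst, simpleCoroot_single, M.symmetric t s, h0, S_eval_two] at h2
    omega
  · refine ⟨by omega, ?_⟩
    by_contra hlt
    obtain rfl : k = 1 := by omega
    rw [pow_one] at h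
    have h1 := DFunLike.congr_fun (LinearEquiv.congr_fun h (Finsupp.single s 1)) s
    simp [simpleReflection, reflection_apply, simpleCoroot_single, M.symmetric t s, h2] at h1
    linarith
  · refine ⟨by omega, ?_⟩
    have hs := sin_two_pi_div_ne_zero h3
    have hm : (M s t : ℝ) ≠ 0 := by positivity
    have hc : Real.cos (Real.pi / M s t) ≠ 0 := by
      intro hc
      apply hs
      rw [mul_div_assoc, Real.sin_two_mul, hc, mul_zero]
    have h1 := LinearEquiv.congr_fun h (Finsupp.single s 1)
    rw [simpleReflection, simpleReflection, reflection_mul_reflection_pow_apply_self _ _ _ _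
      (M.simpleCoroot_mul_simpleCoroot s t).symm] at h1
    have ht := DFunLike.congr_fun h1 t
    have hs' := DFunLike.congr_fun h1 s
    have key (n : ℤ) := S_two_mul_real_cos (2 * Real.pi / M s t) n
    have k1 := key k
    have k2 := key (k - 1)
    simp [hst, hst.symm, simpleCoroot_single, M.symmetric t s, hc] at ht hs'
    rw [ht] at hs' k2
    rw [add_zero] at hs'
    rw [hs', add_mul, one_mul, one_mul, Real.sin_add] at k1
    push_cast at k1 k2
    rw [sub_add_cancel, zero_mul] at k2
    rw [← k2, zero_mul, zero_add] at k1
    have hcos : Real.cos (k * (2 * Real.pi / M s t)) = 1 := by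
      apply mul_right_cancel₀ hs
      rw [one_mul]
      exact k1.symm
    obtain ⟨n, hn⟩ := (Real.cos_eq_one_iff _).mp hcos
    have hpi := Real.pi_ne_zero
    field_simp at hn
    have hn' : n * (M s t : ℤ) = k := by exact_mod_cast hn
    exact Nat.le_of_dvd hk (Int.natCast_dvd_natCast.mp ⟨n, by rw [← hn', mul_comm]⟩)

end CoxeterMatrix

namespace CoxeterSystem

variable {S W : Type*} [Group W] {M : CoxeterMatrix S} (cs : CoxeterSystem M W)

theorem le_of_simple_mul_simple_pow {s t : S} (hst : s ≠ t) {k : ℕ} (hk : 0 < k)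
    (h : (cs.simple s * cs.simple t) ^ k = 1) : M s t ≠ 0 ∧ M s t ≤ k := by
  apply M.le_of_simpleReflection_mul_pow hst hk
  have hl : M.IsLiftable M.simpleReflection := M.simpleReflection_mul_pow
  have := congrArg (cs.lift ⟨M.simpleReflection, hl⟩) h
  rwa [map_pow, map_mul, cs.lift_apply_simple, cs.lift_apply_simple, map_one] at this

end CoxeterSystem

/-- The alternating list `a, b, a, b, …` of length `m`. -/
def altList {α : Type*} : α → α → ℕ → List α
  | _, _, 0 => []
  | a, b, m + 1 => a :: altList b a m

section altList

variable {α : Type*}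

@[simp]
theorem length_altList (a b : α) (m : ℕ) : (altList a b m).length = m := by
  induction m generalizing a b with
  | zero => rfl
  | succ m ih => simp [altList, ih]

theorem eq_or_eq_of_mem_altList {a b x : α} {m : ℕ} (hx : x ∈ altList a b m) :
    x = a ∨ x = b := by
  induction m generalizing a b with
  | zero => simp [altList] at hx
  | succ m ih =>
    rcases List.mem_cons.mp hx with h | h
    · exact Or.inl h
    · exact (ih h).symm

theorem reverse_altList (a b : α) (m : ℕ) :
    (altList a b m).reverse = CoxeterSystem.alternatingWord b a m := by
  induction m generalizing a b with
  | zero => rfl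
  | succ m ih => simp [altList, ih, CoxeterSystem.alternatingWord_succ]

theorem prod_map_altList_two_mul {G : Type*} [Monoid G] (f : α → G) (a b : α) (m : ℕ) :
    ((altList a b (2 * m)).map f).prod = (f a * f b) ^ m := by
  induction m with
  | zero => simp [altList]
  | succ m ih =>
    rw [show 2 * (m + 1) = 2 * m + 1 + 1 by ring, altList, altList]
    simp [ih, pow_succ', mul_assoc]

end altList

namespace CoxeterSystem

variable {S W : Type*} [Group W] {M : CoxeterMatrix S} (cs : CoxeterSystem M W)

theorem wordProd_altList_eq (s t : S) :
    cs.wordProd (altList s t (M s t)) = cs.wordProd (altList t s (M s t)) := by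
  have h := cs.wordProd_braidWord_eq s t
  rw [braidWord, braidWord, M.symmetric t s, ← reverse_altList, ← reverse_altList,
    wordProd_reverse, wordProd_reverse] at h
  exact (inv_injective h).symm

theorem leftInvSeq_altList (s t : S) (n : ℕ) :
    cs.leftInvSeq (altList s t n) =
      (List.range n).map fun k => (cs.simple s * cs.simple t) ^ k * cs.simple s := by
  induction n generalizing s t with
  | zero => simp [altList]
  | succ n ih =>
    have h (k : ℕ) : cs.simple s * (cs.simple t * cs.simple s) ^ k =
        (cs.simple s * cs.simple t) ^ k * cs.simple s := by
      induction k with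
      | zero => simp
      | succ k ih => rw [pow_succ, ← mul_assoc, ih, pow_succ]; simp only [mul_assoc]
    rw [altList, leftInvSeq, ih, List.range_succ_eq_map]
    simp only [List.map_map, List.map_cons, pow_zero, one_mul, List.cons.injEq, true_and]
    apply List.map_congr_left
    intro k _
    simp only [Function.comp_apply, MulAut.conj_apply, inv_simple]
    rw [← mul_assoc, h, pow_succ]
    simp only [mul_assoc]

theorem leftInvSeq_altList_swap (s t : S) :
    cs.leftInvSeq (altList t s (M s t)) = (cs.leftInvSeq (altList s t (M s t))).reverse := by
  rw [leftInvSeq_altList, leftInvSeq_altList]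
  apply List.ext_getElem
  · simp
  intro k hk _
  simp only [List.length_map, List.length_range] at hk
  simp only [List.getElem_map, List.getElem_range, List.getElem_reverse, List.length_map,
    List.length_range]
  have h1 : cs.simple t * cs.simple s = (cs.simple s * cs.simple t)⁻¹ := by simp
  have h2 : cs.simple t = (cs.simple s * cs.simple t)⁻¹ * cs.simple s := by simp [mul_assoc]
  have h3 := cs.simple_mul_simple_pow s t
  rw [h1]
  nth_rw 2 [h2]
  rw [← mul_assoc, ← pow_succ, inv_pow]
  congr 1
  rw [inv_eq_iff_mul_eq_one, ← pow_add]
  convert h3 using 2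
  omega

open Classical in
/-- The action of a simple generator on pairs of a group element and a sign. -/
noncomputable def signAct (s : S) : Equiv.Perm (W × ZMod 2) :=
  Function.Involutive.toPerm
    (fun p => (cs.simple s * p.1 * cs.simple s, p.2 + if p.1 = cs.simple s then 1 else 0)) (by
      rintro ⟨t, ε⟩
      have h : cs.simple s * t * cs.simple s = cs.simple s ↔ t = cs.simple s := by
        rw [mul_assoc, mul_eq_left, mul_eq_one_iff_eq_inv, inv_simple]
      simp only [h, Prod.mk.injEq]
      refine ⟨by simp [mul_assoc], ?_⟩
      rw [add_assoc, CharTwo.add_self_eq_zero, add_zero])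

open Classical in
theorem signAct_apply (s : S) (p : W × ZMod 2) : cs.signAct s p =
    (cs.simple s * p.1 * cs.simple s, p.2 + if p.1 = cs.simple s then 1 else 0) := rfl

theorem signAct_inv (s : S) : (cs.signAct s)⁻¹ = cs.signAct s := rfl

open Classical in
theorem inv_prod_signAct_apply (ω : List S) (p : W × ZMod 2) :
    ((ω.map cs.signAct).prod)⁻¹ p =
      ((cs.wordProd ω)⁻¹ * p.1 * cs.wordProd ω, p.2 + ((cs.leftInvSeq ω).count p.1 : ZMod 2)) := by
  induction ω generalizing p with
  | nil => simp
  | cons s ω ih =>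
    have h : ((cs.leftInvSeq ω).map (MulAut.conj (cs.simple s))).count p.1 =
        (cs.leftInvSeq ω).count (cs.simple s * p.1 * cs.simple s) := by
      conv_lhs => rw [show p.1 = MulAut.conj (cs.simple s) (cs.simple s * p.1 * cs.simple s) by
        simp [mul_assoc]]
      rw [List.count_map_of_injective _ _ (MulAut.conj (cs.simple s)).injective]
    rw [List.map_cons, List.prod_cons, mul_inv_rev, Equiv.Perm.mul_apply, signAct_inv,
      signAct_apply, ih, leftInvSeq, List.count_cons, h, wordProd_cons]
    simp only [mul_inv_rev, inv_simple, mul_assoc, Prod.mk.injEq, true_and, beq_iff_eq]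
    rw [show (cs.simple s = p.1) = (p.1 = cs.simple s) from propext eq_comm]
    push_cast
    ring

theorem isLiftable_signAct : M.IsLiftable cs.signAct := by
  classical
  intro s t
  rw [← prod_map_altList_two_mul, ← inv_eq_one]
  ext1 p
  rw [inv_prod_signAct_apply, leftInvSeq_altList, two_mul, List.range_add, List.map_append,
    List.count_append, List.map_map]
  have h : ((fun k => (cs.simple s * cs.simple t) ^ k * cs.simple s) ∘ fun x => M s t + x) =
      fun k => (cs.simple s * cs.simple t) ^ k * cs.simple s := by
    funext k
    simp [pow_add]
  rw [h, ← two_mul, wordProd, prod_map_altList_two_mul, simple_mul_simple_pow, ← two_mul,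
    Nat.cast_mul, Nat.cast_ofNat, show (2 : ZMod 2) = 0 from rfl]
  simp

open Classical in
theorem count_leftInvSeq_congr {ω ω' : List S} (h : cs.wordProd ω = cs.wordProd ω') (t : W) :
    ((cs.leftInvSeq ω).count t : ZMod 2) = (cs.leftInvSeq ω').count t := by
  have key (ω : List S) : (ω.map cs.signAct).prod =
      cs.lift ⟨cs.signAct, cs.isLiftable_signAct⟩ (cs.wordProd ω) := by
    rw [wordProd, map_list_prod, List.map_map]
    congr 1
    apply List.map_congr_left
    intro s _
    exact (cs.lift_apply_simple cs.isLiftable_signAct s).symm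
  have h1 := cs.inv_prod_signAct_apply ω (t, 0)
  rw [key, h, ← key, inv_prod_signAct_apply] at h1
  simpa using (congrArg Prod.snd h1).symm

/-- The exchange property for left descents. -/
theorem exists_simple_mul_eq_wordProd_eraseIdx {s : S} {ω : List S}
    (h : cs.IsLeftDescent (cs.wordProd ω) s) :
    ∃ k < ω.length, cs.simple s * cs.wordProd ω = cs.wordProd (ω.eraseIdx k) := by
  classical
  have hmem : cs.simple s ∈ cs.leftInvSeq ω := by
    by_contra hmem
    obtain ⟨ω', hω', hw⟩ := cs.exists_isReduced (cs.simple s * cs.wordProd ω)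
    have h1 := cs.count_leftInvSeq_congr (ω := ω) (ω' := s :: ω')
      (by rw [wordProd_cons, ← hw, simple_mul_simple_cancel_left]) (cs.simple s)
    have h2 : cs.simple s ∉ cs.leftInvSeq ω' := by
      intro hm
      have := (cs.isLeftInversion_of_mem_leftInvSeq hω' hm).2
      rw [← hw, simple_mul_simple_cancel_left] at this
      exact absurd h (not_lt.mpr this.le)
    have h3 : cs.simple s ∉ (cs.leftInvSeq ω').map (MulAut.conj (cs.simple s)) := by
      intro hm
      obtain ⟨t, ht, hts⟩ := List.mem_map.mp hm
      have : t = cs.simple s := by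
        apply (MulAut.conj (cs.simple s)).injective
        rw [hts]
        simp
      exact h2 (this ▸ ht)
    rw [leftInvSeq, List.count_cons_self, List.count_eq_zero_of_not_mem hmem,
      List.count_eq_zero_of_not_mem h3] at h1
    simp at h1
  obtain ⟨k, hk, hks⟩ := List.getElem_of_mem hmem
  refine ⟨k, by simpa using hk, ?_⟩
  rw [← getD_leftInvSeq_mul_wordProd, List.getD_eq_getElem _ _ hk, hks]

/-- The exchange property for right descents. -/
theorem exists_wordProd_mul_simple_eq_wordProd_eraseIdx {s : S} {ω : List S}
    (h : cs.IsRightDescent (cs.wordProd ω) s) :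
    ∃ k < ω.length, cs.wordProd ω * cs.simple s = cs.wordProd (ω.eraseIdx k) := by
  rw [← isLeftDescent_inv_iff, ← wordProd_reverse] at h
  obtain ⟨k, hk, hks⟩ := cs.exists_simple_mul_eq_wordProd_eraseIdx h
  rw [List.length_reverse] at hk
  refine ⟨ω.length - 1 - k, by omega, ?_⟩
  apply inv_injective
  rw [mul_inv_rev, inv_simple, ← wordProd_reverse, hks, ← wordProd_reverse,
    List.eraseIdx_eq_take_drop_succ, List.eraseIdx_eq_take_drop_succ, List.reverse_append,
    List.take_reverse, List.drop_reverse]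
  congr 4 <;> omega

theorem exists_altList_append {w : W} {s t : S} (hst : s ≠ t) (hs : cs.IsLeftDescent w s)
    (ht : cs.IsLeftDescent w t) (k : ℕ) (hk : M s t = 0 ∨ k ≤ M s t) :
    ∃ ν : List S, w = cs.wordProd (altList s t k ++ ν) ∧ k + ν.length = cs.length w := by
  induction k generalizing s t with
  | zero =>
    obtain ⟨ν, hν, hw⟩ := cs.exists_isReduced w
    refine ⟨ν, hw, ?_⟩
    rw [hw, hν.eq, zero_add]
  | succ k ih =>
    obtain ⟨ν, hw, hl⟩ := ih hst.symm ht hs (by rw [M.symmetric t s]; omega)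
    have hs' := hs
    rw [hw] at hs'
    obtain ⟨j, hj, he⟩ := cs.exists_simple_mul_eq_wordProd_eraseIdx hs'
    rw [← hw] at he
    by_cases hjk : j < k
    · exfalso
      rw [List.eraseIdx_append_of_lt_length (by simpa using hjk), hw, wordProd_append,
        wordProd_append, ← mul_assoc, mul_left_inj, ← getD_leftInvSeq_mul_wordProd, mul_left_inj,
        leftInvSeq_altList, List.getD_eq_getElem _ _ (by simpa using hjk), List.getElem_map,
        List.getElem_range] at he
      have h1 : (cs.simple t * cs.simple s) ^ (j + 1) = 1 := by
        rw [pow_succ, ← mul_assoc, ← he, simple_mul_simple_self]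
      have := cs.le_of_simple_mul_simple_pow hst.symm (Nat.succ_pos j) h1
      rw [M.symmetric t s] at this
      omega
    · rw [List.eraseIdx_append_of_length_le (by simpa using hjk), length_altList] at he
      rw [List.length_append, length_altList] at hj
      refine ⟨ν.eraseIdx (j - k), ?_, ?_⟩
      · rw [altList, List.cons_append, wordProd_cons, ← he, simple_mul_simple_cancel_left]
      · rw [List.length_eraseIdx_of_lt (by omega)]
        omega

theorem IsReduced.of_cons {cs : CoxeterSystem M W} {s : S} {ω : List S}
    (h : cs.IsReduced (s :: ω)) : cs.IsReduced ω := by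
  simpa using h.drop 1

/-- Matsumoto's theorem. -/
theorem IsReduced.prod_map_eq {cs : CoxeterSystem M W} {G : Type*} [Monoid G] {f : S → G}
    (hf : ∀ s t, s ≠ t → M s t ≠ 0 →
      ((altList s t (M s t)).map f).prod = ((altList t s (M s t)).map f).prod)
    {ω ω' : List S} (hω : cs.IsReduced ω) (hω' : cs.IsReduced ω')
    (h : cs.wordProd ω = cs.wordProd ω') : (ω.map f).prod = (ω'.map f).prod := by
  induction hn : ω.length generalizing ω ω' with
  | zero =>
    have hl : ω'.length = 0 := by rw [← hω'.eq, ← h, hω.eq, hn]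
    rw [List.length_eq_zero_iff.mp hn, List.length_eq_zero_iff.mp hl]
  | succ n ih =>
    have hl : ω'.length = n + 1 := by rw [← hω'.eq, ← h, hω.eq, hn]
    obtain ⟨s, α, rfl⟩ := List.exists_cons_of_length_eq_add_one hn
    obtain ⟨t, β, rfl⟩ := List.exists_cons_of_length_eq_add_one hl
    rw [List.length_cons, Nat.add_right_cancel_iff] at hn hl
    rw [List.map_cons, List.prod_cons, List.map_cons, List.prod_cons]
    by_cases hst : s = t
    · subst hst
      rw [wordProd_cons, wordProd_cons, mul_right_inj] at h
      rw [ih hω.of_cons hω'.of_cons h hn]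
    have hdesc {r : S} {γ : List S} (hγ : cs.IsReduced (r :: γ)) :
        cs.IsLeftDescent (cs.wordProd (r :: γ)) r := by
      rw [IsLeftDescent, hγ.eq, wordProd_cons, simple_mul_simple_cancel_left, hγ.of_cons.eq]
      simp
    have hs := hdesc hω
    have ht := hdesc hω'
    rw [← h] at ht
    have hM : M s t ≠ 0 := by
      intro h0
      obtain ⟨ν, -, hν⟩ := cs.exists_altList_append hst hs ht
        (cs.length (cs.wordProd (s :: α)) + 1) (Or.inl h0)
      omega
    obtain ⟨ν, hw, hν⟩ := cs.exists_altList_append hst hs ht (M s t) (Or.inr le_rfl)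
    have hw' := hw
    rw [wordProd_append, wordProd_altList_eq, ← wordProd_append, h] at hw'
    have step {r q : S} {γ : List S} (hγ : cs.IsReduced (r :: γ)) (hγn : γ.length = n)
        (hr : cs.wordProd (r :: γ) = cs.wordProd (altList r q (M s t) ++ ν)) :
        f r * (γ.map f).prod = ((altList r q (M s t)).map f).prod * (ν.map f).prod := by
      rw [hω.eq, List.length_cons, hn] at hν
      obtain ⟨m, hm⟩ := Nat.exists_eq_succ_of_ne_zero hM
      rw [hm] at hr hν ⊢
      rw [altList, List.cons_append, wordProd_cons, wordProd_cons, mul_right_inj] at hr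
      rw [altList, List.map_cons, List.prod_cons, mul_assoc, ih hγ.of_cons _ hr hγn,
        List.map_append, List.prod_append]
      rw [IsReduced, ← hr, hγ.of_cons.eq, List.length_append, length_altList]
      omega
    rw [step hω hn hw, step hω' hl hw', hf s t hst hM]

end CoxeterSystem

namespace CoxeterSystem

variable {S W : Type*} [Group W] {M : CoxeterMatrix S} (cs : CoxeterSystem M W)

theorem simple_injective : Function.Injective cs.simple := by
  intro s t h
  by_contra hst
  have h1 := cs.le_of_simple_mul_simple_pow hst one_pos
    (by rw [h, simple_mul_simple_self, one_pow])
  have := M.off_diagonal s t hst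
  omega

/-- The standard parabolic subgroup generated by a set of simple generators. -/
def parabolic (J : Set S) : Subgroup W := Subgroup.closure (cs.simple '' J)

variable {cs}

theorem simple_mem_parabolic {J : Set S} {s : S} (hs : s ∈ J) : cs.simple s ∈ cs.parabolic J :=
  Subgroup.subset_closure ⟨s, hs, rfl⟩

theorem wordProd_mem_parabolic {J : Set S} {δ : List S} (hδ : ∀ c ∈ δ, c ∈ J) :
    cs.wordProd δ ∈ cs.parabolic J := by
  apply Subgroup.list_prod_mem
  intro w hw
  obtain ⟨c, hc, rfl⟩ := List.mem_map.mp hw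
  exact simple_mem_parabolic (hδ c hc)

theorem exists_wordProd_of_mem_parabolic {J : Set S} {d : W} (hd : d ∈ cs.parabolic J) :
    ∃ δ : List S, (∀ c ∈ δ, c ∈ J) ∧ cs.wordProd δ = d := by
  induction hd using Subgroup.closure_induction with
  | mem x hx =>
    obtain ⟨c, hc, rfl⟩ := hx
    exact ⟨[c], by simpa using hc, by simp⟩
  | one => exact ⟨[], by simp, by simp⟩
  | mul x y _ _ hx hy =>
    obtain ⟨α, hα, rfl⟩ := hx
    obtain ⟨β, hβ, rfl⟩ := hy
    refine ⟨α ++ β, ?_, by rw [wordProd_append]⟩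
    intro c hc
    exact (List.mem_append.mp hc).elim (hα c) (hβ c)
  | inv x _ hx =>
    obtain ⟨α, hα, rfl⟩ := hx
    exact ⟨α.reverse, by simpa using hα, by rw [wordProd_reverse]⟩

/-- A word over `J` that is shortest among the words over `J` representing the same element. -/
def IsShortest (cs : CoxeterSystem M W) (J : Set S) (δ : List S) : Prop :=
  (∀ c ∈ δ, c ∈ J) ∧ ∀ δ' : List S, (∀ c ∈ δ', c ∈ J) →
    cs.wordProd δ' = cs.wordProd δ → δ.length ≤ δ'.length

theorem exists_isShortest {J : Set S} {d : W} (hd : d ∈ cs.parabolic J) :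
    ∃ δ : List S, cs.IsShortest J δ ∧ cs.wordProd δ = d := by
  obtain ⟨δ, ⟨hδ, hd'⟩, hmin⟩ := (measure (List.length (α := S))).wf.has_min
    {δ | (∀ c ∈ δ, c ∈ J) ∧ cs.wordProd δ = d} (exists_wordProd_of_mem_parabolic hd)
  refine ⟨δ, ⟨hδ, fun δ' h1 h2 => ?_⟩, hd'⟩
  exact not_lt.mp (hmin δ' ⟨h1, h2.trans hd'⟩)

theorem IsShortest.of_cons {J : Set S} {s : S} {δ : List S} (h : cs.IsShortest J (s :: δ)) :
    cs.IsShortest J δ := by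
  refine ⟨fun c hc => h.1 c (List.mem_cons_of_mem _ hc), fun δ' h1 h2 => ?_⟩
  have := h.2 (s :: δ') (fun c hc => ?_) (by rw [wordProd_cons, wordProd_cons, h2])
  · simpa using this
  · rcases List.mem_cons.mp hc with rfl | hc
    · exact h.1 c (List.mem_cons_self ..)
    · exact h1 c hc

theorem IsShortest.length_mul {J : Set S} {w : W}
    (hw : ∀ d ∈ cs.parabolic J, cs.length w ≤ cs.length (d * w)) {δ : List S}
    (hδ : cs.IsShortest J δ) : cs.length (cs.wordProd δ * w) = δ.length + cs.length w := by
  induction δ with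
  | nil => simp
  | cons s δ ih =>
    have ih := ih hδ.of_cons
    rw [wordProd_cons, mul_assoc]
    rcases cs.length_simple_mul (cs.wordProd δ * w) s with h | h
    · rw [h, ih, List.length_cons]
      ring
    exfalso
    obtain ⟨ν, hν, rfl⟩ := cs.exists_isReduced w
    rw [← wordProd_append] at h
    obtain ⟨k, hk, he⟩ := cs.exists_simple_mul_eq_wordProd_eraseIdx (s := s)
      (ω := δ ++ ν) (by rw [IsLeftDescent]; omega)
    by_cases hkδ : k < δ.length
    · rw [List.eraseIdx_append_of_lt_length hkδ, wordProd_append, wordProd_append, ← mul_assoc,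
        mul_left_inj, ← wordProd_cons] at he
      have := hδ.2 (δ.eraseIdx k)
        (fun c hc => hδ.of_cons.1 c (List.mem_of_mem_eraseIdx hc)) he.symm
      rw [List.length_eraseIdx_of_lt hkδ, List.length_cons] at this
      omega
    · rw [not_lt] at hkδ
      rw [List.length_append] at hk
      rw [List.eraseIdx_append_of_length_le hkδ, wordProd_append, wordProd_append, ← mul_assoc,
        ← wordProd_cons] at he
      have h1 := hw ((cs.wordProd δ)⁻¹ * cs.wordProd (s :: δ))
        (mul_mem (inv_mem (wordProd_mem_parabolic hδ.of_cons.1)) (wordProd_mem_parabolic hδ.1))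
      rw [mul_assoc, he, inv_mul_cancel_left, hν.eq] at h1
      have h2 := cs.length_wordProd_le (ν.eraseIdx (k - δ.length))
      rw [List.length_eraseIdx_of_lt (by omega)] at h2
      omega

variable (cs)

/-- Elements that are of minimal length in their left coset of a standard parabolic subgroup. -/
def IsCosetMin (X : Set S) (w : W) : Prop := ∀ x ∈ X, ¬ cs.IsRightDescent w x

variable {cs} {X : Set S}

theorem isCosetMin_one : cs.IsCosetMin X 1 := fun x _ => cs.not_isRightDescent_one x

theorem IsCosetMin.simple_mul {w : W} (hw : cs.IsCosetMin X w) {s : S}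
    (hs : ¬ ∃ x ∈ X, cs.simple s * w = w * cs.simple x) : cs.IsCosetMin X (cs.simple s * w) := by
  intro x hx hd
  have hwx := hw x hx
  rw [not_isRightDescent_iff] at hwx
  have hd' := cs.isRightDescent_iff.mp hd
  rcases cs.length_simple_mul w s with h | h
  · obtain ⟨ω, hω, rfl⟩ := cs.exists_isReduced w
    rw [← wordProd_cons] at hd
    obtain ⟨k, hk, he⟩ := cs.exists_wordProd_mul_simple_eq_wordProd_eraseIdx hd
    rw [wordProd_cons] at he
    cases k with
    | zero =>
      apply hs
      refine ⟨x, hx, ?_⟩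
      rw [List.eraseIdx_cons_zero] at he
      rw [← mul_left_inj (cs.simple x), he, simple_mul_simple_cancel_right]
    | succ k =>
      rw [List.eraseIdx_cons_succ, wordProd_cons, mul_assoc, mul_right_inj] at he
      have h2 := cs.length_wordProd_le (ω.eraseIdx k)
      rw [List.length_cons] at hk
      rw [← he, List.length_eraseIdx_of_lt (by omega), hwx, hω.eq] at h2
      omega
  · rw [mul_assoc] at hd'
    rcases cs.length_simple_mul (w * cs.simple x) s with h' | h' <;> omega

theorem IsCosetMin.eq_simple_or_eq_simple {w : W} (hw : cs.IsCosetMin X w) {s t x y : S}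
    (hx : x ∈ X) (hy : y ∈ X) (hxy : x ≠ y) (hxJ : w * cs.simple x * w⁻¹ ∈ cs.parabolic {s, t})
    (hyJ : w * cs.simple y * w⁻¹ ∈ cs.parabolic {s, t}) :
    (cs.simple s * w = w * cs.simple x ∧ cs.simple t * w = w * cs.simple y) ∨
      (cs.simple s * w = w * cs.simple y ∧ cs.simple t * w = w * cs.simple x) := by
  obtain ⟨w₀, ⟨d, hd, hw₀⟩, hmin⟩ := (measure cs.length).wf.has_min
    {v | ∃ d ∈ cs.parabolic {s, t}, v = d * w} ⟨w, 1, one_mem _, by simp⟩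
  obtain ⟨δ, hδ, hδd⟩ := exists_isShortest (inv_mem hd)
  have hmin' : ∀ d ∈ cs.parabolic {s, t}, cs.length w₀ ≤ cs.length (d * w₀) := by
    intro e he
    exact not_lt.mp (hmin (e * w₀) ⟨e * d, mul_mem he hd, by rw [hw₀, mul_assoc]⟩)
  have hwδ : w = cs.wordProd δ * w₀ := by rw [hδd, hw₀, inv_mul_cancel_left]
  have hlen : cs.length w = δ.length + cs.length w₀ := by rw [hwδ, hδ.length_mul hmin']
  have key {z : S} (hz : z ∈ X) (hzJ : w * cs.simple z * w⁻¹ ∈ cs.parabolic {s, t}) :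
      ∃ c : S, (c = s ∨ c = t) ∧ cs.simple c * w₀ = w₀ * cs.simple z := by
    have h1 : w₀ * cs.simple z * w₀⁻¹ ∈ cs.parabolic {s, t} := by
      have := mul_mem (mul_mem hd hzJ) (inv_mem hd)
      rw [hw₀]
      convert this using 1
      group
    obtain ⟨ρ, hρ, hρz⟩ := exists_isShortest h1
    have hl := hρ.length_mul hmin'
    have hz' := hw z hz
    rw [not_isRightDescent_iff, hlen, hwδ, mul_assoc] at hz'
    have hle := cs.length_mul_le (cs.wordProd δ) (w₀ * cs.simple z)
    have hle' := cs.length_wordProd_le δ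
    have hle'' := cs.length_mul_simple w₀ z
    rw [hρz, inv_mul_cancel_right] at hl
    obtain ⟨c, rfl⟩ := List.length_eq_one_iff.mp (show ρ.length = 1 by omega)
    refine ⟨c, by simpa using hρ.1 c, ?_⟩
    rw [wordProd_singleton] at hρz
    rw [hρz, inv_mul_cancel_right]
  obtain ⟨a, ha, hax⟩ := key hx hxJ
  obtain ⟨b, hb, hby⟩ := key hy hyJ
  have hab : a ≠ b := by
    rintro rfl
    rw [hax, mul_right_inj] at hby
    exact hxy (cs.simple_injective hby)
  have hδ0 : δ = [] := by
    rcases List.eq_nil_or_concat δ with h | ⟨δ', c, rfl⟩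
    · exact h
    exfalso
    rw [List.concat_eq_append] at hwδ hlen hδ
    have hc : c = s ∨ c = t := by simpa using hδ.1 c (by simp)
    have hcz : ∃ z ∈ X, cs.simple c * w₀ = w₀ * cs.simple z := by
      have : c = a ∨ c = b := by
        rcases ha with rfl | rfl <;> rcases hb with rfl | rfl <;> rcases hc with rfl | rfl <;>
          first | exact Or.inl rfl | exact Or.inr rfl | exact absurd rfl hab
      rcases this with rfl | rfl
      · exact ⟨x, hx, hax⟩
      · exact ⟨y, hy, hby⟩
    obtain ⟨z, hz, hcz⟩ := hcz
    apply hw z hz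
    rw [wordProd_append, wordProd_singleton, mul_assoc, hcz] at hwδ
    rw [IsRightDescent, hlen, hwδ, ← mul_assoc, simple_mul_simple_cancel_right]
    have hle := cs.length_mul_le (cs.wordProd δ') w₀
    have hle' := cs.length_wordProd_le δ'
    simp only [List.length_append, List.length_singleton]
    omega
  rw [hδ0, wordProd_nil, one_mul] at hwδ
  rw [hwδ]
  rcases ha with rfl | rfl <;> rcases hb with rfl | rfl
  · exact absurd rfl hab
  · exact Or.inl ⟨hax, hby⟩
  · exact Or.inr ⟨hby, hax⟩
  · exact absurd rfl hab

theorem coxeterMatrix_eq_of_conj {w : W} {s t x y : S} (hst : s ≠ t) (hM : M s t ≠ 0)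
    (hs : cs.simple s * w = w * cs.simple x) (ht : cs.simple t * w = w * cs.simple y) :
    x ≠ y ∧ M x y = M s t := by
  have hxy : x ≠ y := by
    rintro rfl
    rw [← ht, mul_left_inj] at hs
    exact hst (cs.simple_injective hs)
  have h (k : ℕ) : (cs.simple s * cs.simple t) ^ k * w = w * (cs.simple x * cs.simple y) ^ k := by
    induction k with
    | zero => simp
    | succ k ih =>
      rw [pow_succ, pow_succ, mul_assoc, mul_assoc, ht, ← mul_assoc (cs.simple s), hs, mul_assoc,
        ← mul_assoc, ih, mul_assoc]
  have h1 := cs.le_of_simple_mul_simple_pow hxy (Nat.pos_of_ne_zero hM) (k := M s t) (by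
    have := h (M s t)
    rwa [simple_mul_simple_pow, one_mul, left_eq_mul] at this)
  have h2 := cs.le_of_simple_mul_simple_pow hst (Nat.pos_of_ne_zero h1.1) (k := M x y) (by
    have := h (M x y)
    rwa [simple_mul_simple_pow, mul_one, mul_eq_right] at this)
  exact ⟨hxy, le_antisymm h1.2 h2.2⟩

section cosetStep

variable {G : Type*} [Group G] (f : S → G)

open Classical in
/-- The action of a simple generator `s` on pairs of a minimal coset representative `w` and a group
element: it moves `w` to `s w` unless `s w = w x` with `x ∈ X`, in which case it acts through the
value at `x` of the given family. -/
noncomputable def cosetStep (s : S) (p : {w : W // cs.IsCosetMin X w} × G) :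
    {w : W // cs.IsCosetMin X w} × G :=
  if h : ∃ x ∈ X, cs.simple s * p.1 = p.1 * cs.simple x then (p.1, f h.choose * p.2)
  else (⟨cs.simple s * p.1, p.1.2.simple_mul h⟩, p.2)

theorem cosetStep_of_eq {s x : S} (hx : x ∈ X) {p : {w : W // cs.IsCosetMin X w} × G}
    (h : cs.simple s * p.1 = p.1 * cs.simple x) : cosetStep f s p = (p.1, f x * p.2) := by
  have h' : ∃ x ∈ X, cs.simple s * p.1 = p.1 * cs.simple x := ⟨x, hx, h⟩
  have hc : h'.choose = x := by
    apply cs.simple_injective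
    rw [← mul_right_inj (p.1 : W), ← h'.choose_spec.2, h]
  rw [cosetStep, dif_pos h', hc]

theorem cosetStep_of_not {s : S} {p : {w : W // cs.IsCosetMin X w} × G}
    (h : ¬ ∃ x ∈ X, cs.simple s * p.1 = p.1 * cs.simple x) :
    cosetStep f s p = (⟨cs.simple s * p.1, p.1.2.simple_mul h⟩, p.2) := by
  rw [cosetStep, dif_neg h]

theorem cosetStep_cosetStep {g : S → G} (hfg : ∀ x, f x * g x = 1) (s : S)
    (p : {w : W // cs.IsCosetMin X w} × G) : cosetStep f s (cosetStep g s p) = p := by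
  by_cases h : ∃ x ∈ X, cs.simple s * p.1 = p.1 * cs.simple x
  · obtain ⟨x, hx, hs⟩ := h
    rw [cosetStep_of_eq g hx hs, cosetStep_of_eq f (p := (p.1, g x * p.2)) hx hs,
      ← mul_assoc, hfg, one_mul]
  · rw [cosetStep_of_not g h, cosetStep_of_not]
    · simp
    · rintro ⟨x, hx, hs⟩
      apply h
      refine ⟨x, hx, ?_⟩
      simp only [simple_mul_simple_cancel_left] at hs
      nth_rw 2 [hs]
      rw [simple_mul_simple_cancel_right]

/-- The permutation `cosetStep`. -/
noncomputable def cosetPerm (cs : CoxeterSystem M W) (X : Set S) (s : S) :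
    Equiv.Perm ({w : W // cs.IsCosetMin X w} × G) where
  toFun := cosetStep f s
  invFun := cosetStep (fun x => (f x)⁻¹) s
  left_inv := cosetStep_cosetStep _ (by simp) s
  right_inv := cosetStep_cosetStep _ (by simp) s

theorem cosetPerm_apply (s : S) (p : {w : W // cs.IsCosetMin X w} × G) :
    cosetPerm f cs X s p = cosetStep f s p := rfl

theorem cosetPerm_inv_apply (s : S) (p : {w : W // cs.IsCosetMin X w} × G) :
    (cosetPerm f cs X s)⁻¹ p = cosetStep (fun x => (f x)⁻¹) s p := rfl

theorem inv_prod_cosetPerm_altList {x y : S} (hx : x ∈ X) (hy : y ∈ X) {s t : S}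
    (p : {w : W // cs.IsCosetMin X w} × G) (hs : cs.simple s * p.1 = p.1 * cs.simple x)
    (ht : cs.simple t * p.1 = p.1 * cs.simple y) (n : ℕ) :
    (((altList s t n).map (cosetPerm f cs X)).prod)⁻¹ p =
      (p.1, (((altList x y n).map f).prod)⁻¹ * p.2) := by
  induction n generalizing s t x y p with
  | zero => simp [altList]
  | succ n ih =>
    rw [altList, altList, List.map_cons, List.prod_cons, mul_inv_rev, Equiv.Perm.mul_apply,
      cosetPerm_inv_apply, cosetStep_of_eq _ hx hs, ih hy hx (p.1, (f x)⁻¹ * p.2) ht hs,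
      List.map_cons, List.prod_cons, mul_inv_rev, mul_assoc]

open Classical in
theorem inv_prod_cosetPerm_apply {J : Set S} {b : G} {c r : W} {ω : List S} (hω : ∀ s ∈ ω, s ∈ J)
    (p : {w : W // cs.IsCosetMin X w} × G)
    (h₁ : ∀ x ∈ X, p.1 * cs.simple x * (p.1 : W)⁻¹ ∈ cs.parabolic J →
      (f x)⁻¹ = b ∧ cs.simple x = c ∧ p.1 * cs.simple x * (p.1 : W)⁻¹ = r)
    (h₂ : (b = 1 ∧ c = 1) ∨ ∃ x ∈ X, p.1 * cs.simple x * (p.1 : W)⁻¹ = r) :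
    ((((ω.map (cosetPerm f cs X)).prod)⁻¹ p).1 : W) =
        (cs.wordProd ω)⁻¹ * p.1 * c ^ (cs.leftInvSeq ω).count r ∧
      (((ω.map (cosetPerm f cs X)).prod)⁻¹ p).2 = b ^ (cs.leftInvSeq ω).count r * p.2 := by
  induction ω generalizing p r with
  | nil => simp
  | cons s ω ih =>
    have hsJ : s ∈ J := hω s (List.mem_cons_self ..)
    have hω' : ∀ s ∈ ω, s ∈ J := fun s hs => hω s (List.mem_cons_of_mem _ hs)
    have hcount : ((cs.leftInvSeq ω).map (MulAut.conj (cs.simple s))).count r =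
        (cs.leftInvSeq ω).count (cs.simple s * r * cs.simple s) := by
      conv_lhs => rw [show r = MulAut.conj (cs.simple s) (cs.simple s * r * cs.simple s) by
        simp [mul_assoc]]
      rw [List.count_map_of_injective _ _ (MulAut.conj (cs.simple s)).injective]
    rw [List.map_cons, List.prod_cons, mul_inv_rev, Equiv.Perm.mul_apply, cosetPerm_inv_apply,
      leftInvSeq, List.count_cons, hcount, wordProd_cons, mul_inv_rev, inv_simple]
    by_cases h : ∃ x ∈ X, cs.simple s * p.1 = p.1 * cs.simple x
    · obtain ⟨x, hx, hs⟩ := h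
      have hconj : p.1 * cs.simple x * (p.1 : W)⁻¹ = cs.simple s := by
        rw [← hs, mul_inv_cancel_right]
      obtain ⟨hb, hc, hr⟩ := h₁ x hx (hconj ▸ simple_mem_parabolic hsJ)
      rw [hconj] at hr
      subst hr
      rw [cosetStep_of_eq _ hx hs, simple_mul_simple_self, one_mul]
      obtain ⟨e1, e2⟩ := ih hω' (p.1, (f x)⁻¹ * p.2) h₁ h₂
      rw [e1, e2, hb]
      simp only [beq_self_eq_true, if_true]
      refine ⟨?_, by rw [pow_succ, mul_assoc]⟩
      rw [mul_assoc _ (cs.simple s), hs, hc, pow_succ', mul_assoc, mul_assoc, mul_assoc,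
        ← mul_assoc c c, ← hc, simple_mul_simple_self, one_mul]
    · rw [cosetStep_of_not _ h]
      have hconj (x : S) : cs.simple s * p.1 * cs.simple x * (cs.simple s * (p.1 : W))⁻¹ =
          cs.simple s * (p.1 * cs.simple x * (p.1 : W)⁻¹) * cs.simple s := by
        simp [mul_assoc]
      obtain ⟨e1, e2⟩ := ih (r := cs.simple s * r * cs.simple s) hω'
        (⟨cs.simple s * p.1, p.1.2.simple_mul h⟩, p.2) (by
          intro x hx hxJ
          rw [hconj] at hxJ ⊢
          have hs := simple_mem_parabolic (cs := cs) hsJ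
          obtain ⟨hb, hc, hr⟩ := h₁ x hx (by
            simpa [mul_assoc] using mul_mem (mul_mem hs hxJ) hs)
          exact ⟨hb, hc, by rw [hr]⟩) (by
          rcases h₂ with h₂ | ⟨x, hx, hr⟩
          · exact Or.inl h₂
          · exact Or.inr ⟨x, hx, by rw [hconj, hr]⟩)
      rw [e1, e2]
      rcases h₂ with ⟨rfl, rfl⟩ | ⟨x, hx, hr⟩
      · simp [mul_assoc]
      · have hne : cs.simple s ≠ r := by
          rintro rfl
          exact h ⟨x, hx, by rw [← hr, inv_mul_cancel_right]⟩
        simp [hne, mul_assoc]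

theorem prod_cosetPerm_altList_eq (hf : ∀ s t, s ≠ t → M s t ≠ 0 →
      ((altList s t (M s t)).map f).prod = ((altList t s (M s t)).map f).prod)
    {s t : S} (hst : s ≠ t) (hM : M s t ≠ 0) :
    ((altList s t (M s t)).map (cosetPerm f cs X)).prod =
      ((altList t s (M s t)).map (cosetPerm f cs X)).prod := by
  classical
  apply inv_injective
  ext1 p
  by_cases h : ∃ x ∈ X, ∃ y ∈ X, x ≠ y ∧ p.1 * cs.simple x * (p.1 : W)⁻¹ ∈ cs.parabolic {s, t} ∧
      p.1 * cs.simple y * (p.1 : W)⁻¹ ∈ cs.parabolic {s, t}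
  · have key {x y : S} (hx : x ∈ X) (hy : y ∈ X) (hs : cs.simple s * p.1 = p.1 * cs.simple x)
        (ht : cs.simple t * p.1 = p.1 * cs.simple y) :
        (((altList s t (M s t)).map (cosetPerm f cs X)).prod)⁻¹ p =
          (((altList t s (M s t)).map (cosetPerm f cs X)).prod)⁻¹ p := by
      obtain ⟨hxy, hMxy⟩ := coxeterMatrix_eq_of_conj hst hM hs ht
      rw [inv_prod_cosetPerm_altList f hx hy p hs ht, inv_prod_cosetPerm_altList f hy hx p ht hs,
        ← hMxy, hf x y hxy (hMxy ▸ hM)]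
    obtain ⟨x, hx, y, hy, hxy, hxJ, hyJ⟩ := h
    rcases p.1.2.eq_simple_or_eq_simple hx hy hxy hxJ hyJ with ⟨hs, ht⟩ | ⟨hs, ht⟩
    · exact key hx hy hs ht
    · exact key hy hx hs ht
  · have hb : ∃ (b : G) (c r : W), (∀ x ∈ X, p.1 * cs.simple x * (p.1 : W)⁻¹ ∈
          cs.parabolic {s, t} → (f x)⁻¹ = b ∧ cs.simple x = c ∧
            p.1 * cs.simple x * (p.1 : W)⁻¹ = r) ∧
        ((b = 1 ∧ c = 1) ∨ ∃ x ∈ X, p.1 * cs.simple x * (p.1 : W)⁻¹ = r) := by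
      by_cases hx : ∃ x ∈ X, p.1 * cs.simple x * (p.1 : W)⁻¹ ∈ cs.parabolic {s, t}
      · obtain ⟨x, hx, hxJ⟩ := hx
        refine ⟨(f x)⁻¹, cs.simple x, _, fun y hy hyJ => ?_, Or.inr ⟨x, hx, rfl⟩⟩
        have : y = x := by
          by_contra hne
          exact h ⟨y, hy, x, hx, hne, hyJ, hxJ⟩
        simp [this]
      · exact ⟨1, 1, 1, fun x hxX hxJ => absurd ⟨x, hxX, hxJ⟩ hx, Or.inl ⟨rfl, rfl⟩⟩
    obtain ⟨b, c, r, h₁, h₂⟩ := hb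
    obtain ⟨e1, e2⟩ := inv_prod_cosetPerm_apply f (J := {s, t}) (ω := altList s t (M s t))
      (fun _ hz => eq_or_eq_of_mem_altList hz) p h₁ h₂
    obtain ⟨e3, e4⟩ := inv_prod_cosetPerm_apply f (J := {s, t}) (ω := altList t s (M s t))
      (fun _ hz => (eq_or_eq_of_mem_altList hz).symm) p h₁ h₂
    rw [leftInvSeq_altList_swap, List.count_reverse] at e3 e4
    rw [← wordProd_altList_eq, ← e1] at e3
    exact Prod.ext (Subtype.ext e3.symm) (e2.trans e4.symm)

end cosetStep

end CoxeterSystem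

namespace Computable

variable {α β σ : Type*} [Primcodable α] [Primcodable β] [Primcodable σ]

theorem list_foldl {f : α → List β} {g : α → σ} {h : α → σ × β → σ} (hf : Computable f)
    (hg : Computable g) (hh : Computable₂ h) :
    Computable fun a => (f a).foldl (fun s b => h a (s, b)) (g a) := by
  have hstep : Computable₂ fun (a : α) (q : ℕ × σ) =>
      (Option.casesOn ((f a)[q.1]?) q.2 fun b => h a (q.2, b) : σ) :=
    (option_casesOn (list_getElem?.comp (hf.comp fst) (fst.comp snd)) (snd.comp snd)
      (hh.comp (fst.comp fst) (pair (snd.comp (snd.comp fst)) snd)).to₂).to₂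
  refine (nat_rec (list_length.comp hf) hg hstep).of_eq fun a => ?_
  have key : ∀ n, (Nat.rec (g a) (fun n s =>
      (Option.casesOn ((f a)[n]?) s fun b => h a (s, b) : σ)) n : σ) =
      ((f a).take n).foldl (fun s b => h a (s, b)) (g a) := by
    intro n
    induction n with
    | zero => rfl
    | succ n ih =>
      rw [List.take_add_one, List.foldl_append, ← ih]
      cases hb : (f a)[n]? <;> simp [hb]
  exact (key _).trans (by rw [List.take_length])

theorem list_foldr {f : α → List β} {g : α → σ} {h : α → β × σ → σ} (hf : Computable f)
    (hg : Computable g) (hh : Computable₂ h) :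
    Computable fun a => (f a).foldr (fun b s => h a (b, s)) (g a) :=
  (list_foldl (list_reverse.comp hf) hg
    (hh.comp fst ((pair snd fst).comp snd)).to₂).of_eq fun a => by simp [List.foldl_reverse]

theorem list_find? {f : α → List β} {p : α → β → Bool} (hf : Computable f) (hp : Computable₂ p) :
    Computable fun a => (f a).find? (p a) := by
  have h : Computable₂ fun (a : α) (q : β × Option β) => bif p a q.1 then some q.1 else q.2 :=
    (cond (hp.comp fst (fst.comp snd)) (option_some.comp (fst.comp snd)) (snd.comp snd)).to₂
  refine (list_foldr hf (const none) h).of_eq fun a => ?_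
  induction f a with
  | nil => rfl
  | cons b l ih => cases hb : p a b <;> simp [hb, ih]

end Computable

section evalWord

variable {A G : Type*} [Group G] (gen : A → G)

@[simp]
theorem evalWord_nil : evalWord gen [] = 1 := rfl

@[simp]
theorem evalWord_cons (p : A × Bool) (w : List (A × Bool)) :
    evalWord gen (p :: w) = (if p.2 then gen p.1 else (gen p.1)⁻¹) * evalWord gen w := by
  simp [evalWord]

@[simp]
theorem evalWord_append (u v : List (A × Bool)) :
    evalWord gen (u ++ v) = evalWord gen u * evalWord gen v := by
  simp [evalWord]

theorem evalWord_map_true (ω : List A) :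
    evalWord gen (ω.map fun a => (a, true)) = (ω.map gen).prod := by
  simp [evalWord, Function.comp_def]

theorem evalWord_reverse_map_not (w : List (A × Bool)) :
    evalWord gen (w.map fun p => (p.1, !p.2)).reverse = (evalWord gen w)⁻¹ := by
  induction w with
  | nil => simp
  | cons p w ih =>
    obtain ⟨a, ε⟩ := p
    cases ε <;> simp [ih]

/-- A solution of the word problem yields an algorithm comparing the values of two words. -/
theorem SolvableWordProblem.exists_computable_eq [Primcodable A] {gen : A → G}
    (h : SolvableWordProblem gen) :
    ∃ e : List (A × Bool) → List (A × Bool) → Bool, Computable₂ e ∧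
      ∀ u v, e u v = true ↔ evalWord gen u = evalWord gen v := by
  obtain ⟨t, ht, hte⟩ := ComputablePred.computable_iff.mp h
  have ht' : ∀ w, t w = true ↔ evalWord gen w = 1 := fun w => (congrFun hte w).symm.to_iff
  have hinv : Computable fun w : List (A × Bool) => (w.map fun p => (p.1, !p.2)).reverse :=
    (Primrec.list_reverse.comp (Primrec.list_map Primrec.id
      (Primrec.pair (Primrec.fst.comp Primrec.snd)
        (Primrec.not.comp (Primrec.snd.comp Primrec.snd))).to₂)).to_comp
  refine ⟨fun u v => t (u ++ (v.map fun p => (p.1, !p.2)).reverse),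
    (ht.comp (Computable.list_append.comp Computable.fst (hinv.comp Computable.snd))).to₂,
    fun u v => ?_⟩
  rw [ht', evalWord_append, evalWord_reverse_map_not, mul_inv_eq_one]

end evalWord

theorem altProd_eq_prod_map_altList {α G : Type*} [Monoid G] (f : α → G) (a b : α) (m : ℕ) :
    altProd (f a) (f b) m = ((altList a b m).map f).prod := by
  induction m generalizing a b with
  | zero => rfl
  | succ m ih =>
    rw [altList, List.map_cons, List.prod_cons, ← ih, altProd, altProd, List.range_succ_eq_map,
      List.map_cons, List.prod_cons, List.map_map]
    congr 2
    refine List.map_congr_left fun i _ => ?_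
    rcases Nat.mod_two_eq_zero_or_one i with h | h <;> simp [h, Nat.succ_mod_two_eq_zero_iff]

theorem map_altProd {G H : Type*} [Monoid G] [Monoid H] (φ : G →* H) (a b : G) (m : ℕ) :
    φ (altProd a b m) = altProd (φ a) (φ b) m := by
  rw [altProd, altProd, map_list_prod, List.map_map]
  congr 2
  funext i
  simp only [Function.comp_apply]
  split <;> rfl

namespace ArtinGroup

variable {S : Type*} (M : CoxeterMatrix S)

theorem prod_map_gen_altList_eq {s t : S} (hst : s ≠ t) (hM : M s t ≠ 0) :
    ((altList s t (M s t)).map (gen M)).prod = ((altList t s (M s t)).map (gen M)).prod := by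
  have h := PresentedGroup.one_of_mem (rels := artinRels M) ⟨s, t, hst, hM, rfl⟩
  rw [map_mul, map_inv, mul_inv_eq_one, map_altProd, map_altProd] at h
  rw [← altProd_eq_prod_map_altList, ← altProd_eq_prod_map_altList]
  exact h

/-- The homomorphism out of an Artin group given by a family satisfying the braid relations. -/
def lift {M : CoxeterMatrix S} {G : Type*} [Group G] (f : S → G)
    (hf : ∀ s t, s ≠ t → M s t ≠ 0 →
      ((altList s t (M s t)).map f).prod = ((altList t s (M s t)).map f).prod) :
    ArtinGroup M →* G :=
  PresentedGroup.toGroup (f := f) (by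
    rintro _ ⟨s, t, hst, hM, rfl⟩
    rw [map_mul, map_inv, mul_inv_eq_one, map_altProd, map_altProd, FreeGroup.lift_apply_of,
      FreeGroup.lift_apply_of, altProd_eq_prod_map_altList, altProd_eq_prod_map_altList,
      hf s t hst hM])

theorem lift_gen {M : CoxeterMatrix S} {G : Type*} [Group G] (f : S → G)
    (hf : ∀ s t, s ≠ t → M s t ≠ 0 →
      ((altList s t (M s t)).map f).prod = ((altList t s (M s t)).map f).prod) (s : S) :
    lift f hf (gen M s) = f s :=
  PresentedGroup.toGroup.of _

variable {M} {W : Type*} [Group W] (cs : CoxeterSystem M W)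

theorem wordProd_eq_of_prod_map_gen_eq {ω ω' : List S}
    (h : (ω.map (gen M)).prod = (ω'.map (gen M)).prod) : cs.wordProd ω = cs.wordProd ω' := by
  have h' := congrArg (lift cs.simple fun s t _ _ => cs.wordProd_altList_eq s t) h
  rw [map_list_prod, map_list_prod, List.map_map, List.map_map] at h'
  have hs : lift cs.simple (fun s t _ _ => cs.wordProd_altList_eq s t) ∘ gen M = cs.simple :=
    funext fun s => lift_gen _ _ s
  rwa [hs] at h'

variable (X : Set S)

/-- The action of an Artin group on pairs of a minimal coset representative of a standard
parabolic subgroup and an element of the Artin group. -/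
noncomputable def cosetAction :
    ArtinGroup M →* Equiv.Perm ({w : W // cs.IsCosetMin X w} × ArtinGroup M) :=
  lift (CoxeterSystem.cosetPerm (gen M) cs X) fun _ _ hst hM =>
    CoxeterSystem.prod_cosetPerm_altList_eq _ (fun _ _ => prod_map_gen_altList_eq M) hst hM

theorem cosetAction_apply_of_mem {g : ArtinGroup M} (hg : g ∈ Subgroup.closure (gen M '' X))
    (a : ArtinGroup M) :
    cosetAction cs X g (⟨1, CoxeterSystem.isCosetMin_one⟩, a) =
      (⟨1, CoxeterSystem.isCosetMin_one⟩, g * a) := by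
  induction hg using Subgroup.closure_induction generalizing a with
  | mem g hg =>
    obtain ⟨x, hx, rfl⟩ := hg
    rw [cosetAction, lift_gen, CoxeterSystem.cosetPerm_apply]
    exact CoxeterSystem.cosetStep_of_eq _ hx (by simp)
  | one => simp
  | mul g g' _ _ ih ih' => rw [map_mul, Equiv.Perm.mul_apply, ih', ih, mul_assoc]
  | inv g _ ih => rw [map_inv, Equiv.Perm.inv_eq_iff_eq, ih, mul_inv_cancel_left]

end ArtinGroup

section cosetReduce

variable {S : Type*}

/-- One step of the computation of the coset action on pairs `(ω, μ)`, where `ω` is a reduced word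
and `μ` a word with letters in `L`, using the test `e` for equality of words. -/
def cosetReduceStep (e : List (S × Bool) → List (S × Bool) → Bool) (L : List S) (p : S × Bool)
    (q : List S × List (S × Bool)) : List S × List (S × Bool) :=
  Option.casesOn ((List.range q.1.length).find? fun k =>
      e (q.1.map fun a => (a, true))
        ((p.1, true) :: (q.1.take k ++ q.1.drop (k + 1)).map fun a => (a, true)))
    (Option.casesOn (L.find? fun x =>
        e ((p.1, true) :: q.1.map fun a => (a, true)) ((q.1 ++ [x]).map fun a => (a, true)))
      (p.1 :: q.1, q.2) fun x => (q.1, (x, p.2) :: q.2))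
    fun k => (q.1.take k ++ q.1.drop (k + 1), q.2)

theorem computable_cosetReduceStep [Primcodable S]
    {e : List (S × Bool) → List (S × Bool) → Bool} (he : Computable₂ e) (L : List S) :
    Computable₂ (cosetReduceStep e L) := by
  have hpos : Primrec fun ω : List S => ω.map fun a => (a, true) :=
    Primrec.list_map Primrec.id (Primrec.pair Primrec.snd (Primrec.const true)).to₂
  have herase : Primrec₂ fun (ω : List S) (k : ℕ) => ω.take k ++ ω.drop (k + 1) :=
    (Primrec.list_append.comp (Primrec.list_take.comp Primrec.snd Primrec.fst)
      (Primrec.list_drop.comp (Primrec.succ.comp Primrec.snd) Primrec.fst)).to₂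
  have hω : Computable fun r : (S × Bool) × List S × List (S × Bool) => r.2.1 :=
    Computable.fst.comp Computable.snd
  have hs : Computable fun r : (S × Bool) × List S × List (S × Bool) => r.1.1 :=
    Computable.fst.comp Computable.fst
  have hμ : Computable fun r : (S × Bool) × List S × List (S × Bool) => r.2.2 :=
    Computable.snd.comp Computable.snd
  have hst : Computable fun r : (S × Bool) × List S × List (S × Bool) => (r.1.1, true) :=
    Computable.pair hs (Computable.const true)
  have h₁ : Computable₂ fun (r : (S × Bool) × List S × List (S × Bool)) (k : ℕ) =>
      e (r.2.1.map fun a => (a, true))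
        ((r.1.1, true) :: (r.2.1.take k ++ r.2.1.drop (k + 1)).map fun a => (a, true)) :=
    (he.comp (hpos.to_comp.comp (hω.comp Computable.fst))
      (Computable.list_cons.comp (hst.comp Computable.fst)
        (hpos.to_comp.comp (herase.to_comp.comp (hω.comp Computable.fst) Computable.snd)))).to₂
  have h₂ : Computable₂ fun (r : (S × Bool) × List S × List (S × Bool)) (x : S) =>
      e ((r.1.1, true) :: r.2.1.map fun a => (a, true))
        ((r.2.1 ++ [x]).map fun a => (a, true)) :=
    (he.comp (Computable.list_cons.comp (hst.comp Computable.fst)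
        (hpos.to_comp.comp (hω.comp Computable.fst)))
      (hpos.to_comp.comp (Computable.list_concat.comp (hω.comp Computable.fst)
        Computable.snd))).to₂
  exact (Computable.option_casesOn
    (Computable.list_find? (Primrec.list_range.to_comp.comp (Computable.list_length.comp hω)) h₁)
    (Computable.option_casesOn (Computable.list_find? (Computable.const L) h₂)
      (Computable.pair (Computable.list_cons.comp hs hω) hμ)
      (Computable.pair (hω.comp Computable.fst) (Computable.list_cons.comp
        (Computable.pair Computable.snd ((Computable.snd.comp Computable.fst).comp Computable.fst))
        (hμ.comp Computable.fst))).to₂)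
    (Computable.pair (herase.to_comp.comp (hω.comp Computable.fst) Computable.snd)
      (hμ.comp Computable.fst)).to₂).to₂

end cosetReduce

namespace ArtinGroup

variable {S W : Type*} [Group W] {M : CoxeterMatrix S} {cs : CoxeterSystem M W} {X : Set S}

/-- A pair of a reduced word and a word with letters in `X` represents a pair of a minimal coset
representative and an element of the Artin group. -/
def Represents (q : List S × List (S × Bool)) (p : {w : W // cs.IsCosetMin X w} × ArtinGroup M) :
    Prop :=
  cs.IsReduced q.1 ∧ cs.wordProd q.1 = p.1 ∧ (∀ l ∈ q.2, l.1 ∈ X) ∧ evalWord (gen M) q.2 = p.2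

theorem prod_map_gen_eq_iff {ω ω' : List S} (hω : cs.IsReduced ω) (hω' : cs.IsReduced ω') :
    (ω.map (gen M)).prod = (ω'.map (gen M)).prod ↔ cs.wordProd ω = cs.wordProd ω' :=
  ⟨wordProd_eq_of_prod_map_gen_eq cs,
    hω.prod_map_eq (fun _ _ => prod_map_gen_altList_eq M) hω'⟩

theorem cosetAction_apply_letter (l : S × Bool)
    (p : {w : W // cs.IsCosetMin X w} × ArtinGroup M) :
    cosetAction cs X (if l.2 then gen M l.1 else (gen M l.1)⁻¹) p =
      CoxeterSystem.cosetStep (fun x => if l.2 then gen M x else (gen M x)⁻¹) l.1 p := by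
  obtain ⟨s, ε⟩ := l
  cases ε
  · simp only [Bool.false_eq_true, if_false, map_inv, cosetAction, lift_gen]
    rfl
  · simp only [if_true, cosetAction, lift_gen]
    rfl

theorem Represents.cosetReduceStep {e : List (S × Bool) → List (S × Bool) → Bool}
    (he : ∀ u v, e u v = true ↔ evalWord (gen M) u = evalWord (gen M) v) {L : List S}
    (hL : ∀ x, x ∈ L ↔ x ∈ X) {q : List S × List (S × Bool)}
    {p : {w : W // cs.IsCosetMin X w} × ArtinGroup M} (h : Represents q p) (l : S × Bool) :
    Represents (cosetReduceStep e L l q)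
      (cosetAction cs X (if l.2 then gen M l.1 else (gen M l.1)⁻¹) p) := by
  obtain ⟨s, ε⟩ := l
  obtain ⟨ω, μ⟩ := q
  obtain ⟨⟨w, hw⟩, a⟩ := p
  obtain ⟨hω, rfl, hμ, rfl⟩ := h
  dsimp only at hω hw hμ
  rw [cosetAction_apply_letter, _root_.cosetReduceStep]
  dsimp only
  have hright : ∀ x ∈ X, cs.length (cs.wordProd ω * cs.simple x) = ω.length + 1 := fun x hx => by
    rw [cs.not_isRightDescent_iff.mp (hw x hx), hω]
  cases hk : (List.range ω.length).find? fun k =>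
      e (ω.map fun a => (a, true))
        ((s, true) :: (ω.take k ++ ω.drop (k + 1)).map fun a => (a, true)) with
  | some k =>
    have hlt := List.mem_range.mp (List.mem_of_find?_eq_some hk)
    have heq := List.find?_some hk
    rw [he, ← List.map_cons (f := fun a => (a, true)), evalWord_map_true, evalWord_map_true] at heq
    dsimp only
    rw [← List.eraseIdx_eq_take_drop_succ] at heq ⊢
    have hprod := wordProd_eq_of_prod_map_gen_eq cs heq
    rw [CoxeterSystem.wordProd_cons] at hprod
    have hprod' : cs.simple s * cs.wordProd ω = cs.wordProd (ω.eraseIdx k) := by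
      rw [hprod, CoxeterSystem.simple_mul_simple_cancel_left]
    have hlen := List.length_eraseIdx_add_one hlt
    have hle := cs.length_wordProd_le (ω.eraseIdx k)
    rw [CoxeterSystem.cosetStep_of_not]
    · refine ⟨?_, hprod'.symm, hμ, rfl⟩
      have h1 := cs.length_simple_mul (cs.wordProd (ω.eraseIdx k)) s
      rw [← hprod, hω] at h1
      rw [CoxeterSystem.IsReduced]
      dsimp only
      omega
    · rintro ⟨x, hx, hsx⟩
      have h1 := hright x hx
      dsimp only at hsx
      rw [← hsx, hprod'] at h1
      omega
  | none =>
    have hcons : cs.IsReduced (s :: ω) := by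
      by_contra hred
      have hdesc : cs.IsLeftDescent (cs.wordProd ω) s := by
        by_contra hdesc
        rw [CoxeterSystem.not_isLeftDescent_iff] at hdesc
        apply hred
        rw [CoxeterSystem.IsReduced, CoxeterSystem.wordProd_cons, hdesc, hω, List.length_cons]
      obtain ⟨k, hlt, hprod⟩ := cs.exists_simple_mul_eq_wordProd_eraseIdx hdesc
      have hprod' : cs.wordProd ω = cs.wordProd (s :: ω.eraseIdx k) := by
        rw [CoxeterSystem.wordProd_cons, ← hprod, CoxeterSystem.simple_mul_simple_cancel_left]
      have hlen := List.length_eraseIdx_add_one hlt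
      have hred' : cs.IsReduced (s :: ω.eraseIdx k) := by
        rw [CoxeterSystem.IsReduced, ← hprod', hω, List.length_cons, hlen]
      refine List.find?_eq_none.mp hk k (List.mem_range.mpr hlt) ?_
      rw [he, ← List.map_cons (f := fun a => (a, true)), evalWord_map_true, evalWord_map_true,
        ← List.eraseIdx_eq_take_drop_succ]
      exact (prod_map_gen_eq_iff hω hred').mpr hprod'
    dsimp only
    cases hx : L.find? fun x =>
        e ((s, true) :: ω.map fun a => (a, true)) ((ω ++ [x]).map fun a => (a, true)) with
    | some x =>
      have hxX := (hL x).mp (List.mem_of_find?_eq_some hx)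
      have heq := List.find?_some hx
      rw [he, ← List.map_cons (f := fun a => (a, true)), evalWord_map_true,
        evalWord_map_true] at heq
      have hprod := wordProd_eq_of_prod_map_gen_eq cs heq
      rw [CoxeterSystem.wordProd_cons, CoxeterSystem.wordProd_append,
        CoxeterSystem.wordProd_singleton] at hprod
      rw [CoxeterSystem.cosetStep_of_eq _ hxX hprod]
      exact ⟨hω, rfl, List.forall_mem_cons.mpr ⟨hxX, hμ⟩, evalWord_cons _ _ _⟩
    | none =>
      rw [CoxeterSystem.cosetStep_of_not]
      · exact ⟨hcons, cs.wordProd_cons s ω, hμ, rfl⟩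
      · rintro ⟨x, hxX, hsx⟩
        have hred : cs.IsReduced (ω ++ [x]) := by
          rw [CoxeterSystem.IsReduced, CoxeterSystem.wordProd_append,
            CoxeterSystem.wordProd_singleton, hright x hxX, List.length_append,
            List.length_singleton]
        refine List.find?_eq_none.mp hx x ((hL x).mpr hxX) ?_
        rw [he, ← List.map_cons (f := fun a => (a, true)), evalWord_map_true, evalWord_map_true]
        refine (prod_map_gen_eq_iff hcons hred).mpr ?_
        rw [CoxeterSystem.wordProd_cons, CoxeterSystem.wordProd_append,
          CoxeterSystem.wordProd_singleton]
        exact hsx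

variable (cs) in
theorem represents_foldr_cosetReduceStep {e : List (S × Bool) → List (S × Bool) → Bool}
    (he : ∀ u v, e u v = true ↔ evalWord (gen M) u = evalWord (gen M) v) {L : List S}
    (hL : ∀ x, x ∈ L ↔ x ∈ X) (v : List (S × Bool)) :
    Represents (v.foldr (_root_.cosetReduceStep e L) ([], []))
      (cosetAction cs X (evalWord (gen M) v) (⟨1, CoxeterSystem.isCosetMin_one⟩, 1)) := by
  induction v with
  | nil => simp [Represents, CoxeterSystem.IsReduced]
  | cons l v ih =>
    rw [evalWord_cons, map_mul, Equiv.Perm.mul_apply]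
    exact ih.cosetReduceStep he hL l

end ArtinGroup

/-- **Proposition 2.13.** If the word problem in the Artin group `A[Γ]` is solvable, then the
strong membership problem for the standard parabolic subgroup `A_X[Γ]` in `A[Γ]` is solvable. -/
theorem artin_strong_membership_of_word_problem {S : Type*} [Fintype S] [DecidableEq S]
    (M : CoxeterMatrix S) (X : Set S)
    (h : SolvableWordProblem (ArtinGroup.gen M)) :
    SolvableStrongMembership (ArtinGroup.gen M) X
      (Subgroup.closure (ArtinGroup.gen M '' X)) := by
  classical
  obtain ⟨e, hec, he⟩ := h.exists_computable_eq
  let L : List S := (Finset.univ.filter (· ∈ X)).toList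
  have hL : ∀ x, x ∈ L ↔ x ∈ X := fun x => by simp [L]
  let ρ : List (S × Bool) → List (S × Bool) := fun w =>
    (w.foldr (cosetReduceStep e L) ([], [])).2
  have hρc : Computable ρ := Computable.snd.comp
    (Computable.list_foldr Computable.id (Computable.const ([], []))
      ((computable_cosetReduceStep hec L).comp (Computable.fst.comp Computable.snd)
        (Computable.snd.comp Computable.snd)).to₂)
  have hρX : ∀ w, ∀ p ∈ ρ w, p.1 ∈ X := fun w =>
    (ArtinGroup.represents_foldr_cosetReduceStep M.toCoxeterSystem he hL w).2.2.1
  refine ⟨fun w => bif e (ρ w) w then some (ρ w) else none,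
    Computable.cond (hec.comp hρc Computable.id) (Computable.option_some.comp hρc)
      (Computable.const none), fun w => ⟨⟨fun hw => ?_, fun hw => ?_⟩, fun μ hμ => ?_⟩⟩
  · have hr := (ArtinGroup.represents_foldr_cosetReduceStep M.toCoxeterSystem he hL w).2.2.2
    rw [ArtinGroup.cosetAction_apply_of_mem _ _ hw, mul_one] at hr
    simp [(he (ρ w) w).mpr hr]
  · have hew : e (ρ w) w = true := by
      by_contra hew
      rw [Bool.not_eq_true] at hew
      simp [hew] at hw
    rw [← (he _ _).mp hew]
    refine Subgroup.list_prod_mem _ fun g hg => ?_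
    obtain ⟨p, hp, rfl⟩ := List.mem_map.mp hg
    have hmem := Subgroup.subset_closure (Set.mem_image_of_mem (ArtinGroup.gen M) (hρX w p hp))
    split
    · exact hmem
    · exact Subgroup.inv_mem _ hmem
  · have hew : e (ρ w) w = true := by
      by_contra hew
      rw [Bool.not_eq_true] at hew
      simp [hew] at hμ
    obtain rfl : ρ w = μ := by simpa [hew] using hμ
    exact ⟨hρX w, (he _ _).mp hew⟩
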